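/- arXiv:2105.03008 — 4 statements merged into one kernel-verified Lean document; each statement's English description precedes it below -/
import Mathlib

section
/- Let 𝒢 be a groupoid, 𝕂 a field and S a 𝕂-cancellative semigroup. A map Γ : 𝒢 → S is a partial projective representation of 𝒢 if and only if: (i) for all x,y ∈ 𝒢 with xy defined, Γ(x⁻¹)Γ(xy) = 0 ⟺ Γ(x)Γ(y) = 0 ⟺ Γ(xy)Γ(y⁻¹) = 0, and Γ(x)Γ(y) = 0 whenever xy is undefined; and (ii) there is a unique partially defined map σ : 𝒢 × 𝒢 → 𝕂* with domain {(x,y) : Γ(x)Γ(y) ≠ 0} such that Γ(x⁻¹)Γ(x)Γ(y) = Γ(x⁻¹)Γ(xy)σ(x,y) and Γ(x)Γ(y)Γ(y⁻¹) = Γ(xy)Γ(y⁻¹)σ(x,y) for all (x,y) in the domain. Moreover, in this case, for every composable triple (x,y,z) ∈ 𝒢³, Γ(x)Γ(y)Γ(z) ≠ 0 implies σ(x,y)σ(xy,z) = σ(x,yz)σ(y,z). -/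
attribute [local instance] Classical.propDecidable

universe u v w

/-- An (algebraic) groupoid: a set with a partially defined associative binary
operation in which every element `g` has a left identity `tgt g` (= `r(g)`),
a right identity `src g` (= `d(g)`) and an inverse `inv g`, a product `mul g h`
being defined precisely when `comp g h`, i.e. `src g = tgt h`. -/
structure PGroupoid (G : Type u) where
  mul : G → G → G
  inv : G → G
  src : G → G
  tgt : G → G
  comp : G → G → Prop
  comp_iff : ∀ g h, comp g h ↔ src g = tgt h
  mul_assoc' : ∀ g h k, comp g h → comp h k → mul (mul g h) k = mul g (mul h k)
  src_mul : ∀ g h, comp g h → src (mul g h) = src h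
  tgt_mul : ∀ g h, comp g h → tgt (mul g h) = tgt g
  comp_inv_left : ∀ g, comp (inv g) g
  comp_inv_right : ∀ g, comp g (inv g)
  inv_mul_self : ∀ g, mul (inv g) g = src g
  mul_inv_self : ∀ g, mul g (inv g) = tgt g
  src_inv : ∀ g, src (inv g) = tgt g
  tgt_inv : ∀ g, tgt (inv g) = src g
  tgt_mul_self : ∀ g, mul (tgt g) g = g
  mul_src_self : ∀ g, mul g (src g) = g
  comp_tgt_self : ∀ g, comp (tgt g) g
  comp_src_self : ∀ g, comp g (src g)
  inv_inv : ∀ g, inv (inv g) = g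
  inv_mul_rev : ∀ g h, comp g h → inv (mul g h) = mul (inv h) (inv g)

/-- The identities of the groupoid. -/
def PGroupoid.isId {G : Type u} (gd : PGroupoid G) (e : G) : Prop := gd.tgt e = e

/-- The data of a `𝕂`-semigroup: a multiplication, a zero and a `𝕂`-action. -/
structure KSgStr (K : Type v) (S : Type w) where
  mul : S → S → S
  zero : S
  smul : K → S → S

/-- `M` is a `𝕂`-semigroup: a semigroup with zero together with a `𝕂`-action such that
`α(βx) = (αβ)x`, `1x = x`, `α(xy) = (αx)y = x(αy)` and `0_𝕂 x = 0`. -/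
def KSgStr.IsKSemigroup {K : Type v} {S : Type w} [Field K] (M : KSgStr K S) : Prop :=
  (∀ x y z : S, M.mul (M.mul x y) z = M.mul x (M.mul y z)) ∧
  (∀ x : S, M.mul M.zero x = M.zero) ∧
  (∀ x : S, M.mul x M.zero = M.zero) ∧
  (∀ (a b : K) (x : S), M.smul a (M.smul b x) = M.smul (a * b) x) ∧
  (∀ x : S, M.smul 1 x = x) ∧
  (∀ (a : K) (x y : S), M.mul (M.smul a x) y = M.smul a (M.mul x y)) ∧
  (∀ (a : K) (x y : S), M.mul x (M.smul a y) = M.smul a (M.mul x y)) ∧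
  (∀ x : S, M.smul 0 x = M.zero)

/-- `M` is `𝕂`-cancellative: `αx = βx` with `x ≠ 0` implies `α = β`. -/
def KSgStr.IsKCancellative {K : Type v} {S : Type w} [Field K] (M : KSgStr K S) : Prop :=
  ∀ (a b : K) (x : S), x ≠ M.zero → M.smul a x = M.smul b x → a = b

/-- Condition (i) of a partial projective representation of the groupoid `gd` on `M`:
for `xy` defined, `Γ(x⁻¹)Γ(xy) = 0 ⟺ Γ(x)Γ(y) = 0 ⟺ Γ(xy)Γ(y⁻¹) = 0`, and
`Γ(x)Γ(y) = 0` whenever `xy` is undefined. -/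
def PPRcondA {G : Type u} {K : Type v} {S : Type w} [Field K]
    (gd : PGroupoid G) (M : KSgStr K S) (Γ : G → S) : Prop :=
  (∀ x y, gd.comp x y →
      ((M.mul (Γ (gd.inv x)) (Γ (gd.mul x y)) = M.zero ↔ M.mul (Γ x) (Γ y) = M.zero) ∧
       (M.mul (Γ x) (Γ y) = M.zero ↔ M.mul (Γ (gd.mul x y)) (Γ (gd.inv y)) = M.zero))) ∧
  (∀ x y, ¬ gd.comp x y → M.mul (Γ x) (Γ y) = M.zero)

/-- `σ` is the factor set of `Γ`: `σ` is nonzero exactly on the pairs with `Γ(x)Γ(y) ≠ 0`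
(the domain of `σ`), and there
`Γ(x⁻¹)Γ(x)Γ(y) = σ(x,y)·Γ(x⁻¹)Γ(xy)` and `Γ(x)Γ(y)Γ(y⁻¹) = σ(x,y)·Γ(xy)Γ(y⁻¹)`. -/
def IsFactorSetOf {G : Type u} {K : Type v} {S : Type w} [Field K]
    (gd : PGroupoid G) (M : KSgStr K S) (Γ : G → S) (σ : G → G → K) : Prop :=
  (∀ x y, σ x y ≠ 0 ↔ M.mul (Γ x) (Γ y) ≠ M.zero) ∧
  (∀ x y, gd.comp x y → M.mul (Γ x) (Γ y) ≠ M.zero →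
      M.mul (M.mul (Γ (gd.inv x)) (Γ x)) (Γ y) =
        M.smul (σ x y) (M.mul (Γ (gd.inv x)) (Γ (gd.mul x y))) ∧
      M.mul (M.mul (Γ x) (Γ y)) (Γ (gd.inv y)) =
        M.smul (σ x y) (M.mul (Γ (gd.mul x y)) (Γ (gd.inv y))))

/-- `Γ : 𝒢 → S` is a partial projective representation: the composition `ξ ∘ Γ` of `Γ` with
the projection `ξ : S → S/λ` (where `u λ v ⟺ u = αv` for some `α ∈ 𝕂*`) is a partial
homomorphism into the quotient semigroup `P(S) = S/λ`; equality of `λ`-classes is expressed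
by the existence of a unit `α : 𝕂*` relating the two sides. -/
def IsPartialProjRep {G : Type u} {K : Type v} {S : Type w} [Field K]
    (gd : PGroupoid G) (M : KSgStr K S) (Γ : G → S) : Prop :=
  (∀ x y, gd.comp x y →
      (∃ α : Kˣ, M.mul (M.mul (Γ (gd.inv x)) (Γ x)) (Γ y) =
          M.smul (α : K) (M.mul (Γ (gd.inv x)) (Γ (gd.mul x y)))) ∧
      (∃ α : Kˣ, M.mul (M.mul (Γ x) (Γ y)) (Γ (gd.inv y)) =
          M.smul (α : K) (M.mul (Γ (gd.mul x y)) (Γ (gd.inv y))))) ∧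
  (∀ x y, ¬ gd.comp x y → ∃ α : Kˣ, M.mul (Γ x) (Γ y) = M.smul (α : K) M.zero)


namespace PGroupoid

variable {G : Type u} (gd : PGroupoid G) {x y z : G}

theorem comp_mul_right (hxy : gd.comp x y) (hyz : gd.comp y z) : gd.comp x (gd.mul y z) := by
  rw [gd.comp_iff, gd.tgt_mul y z hyz, ← gd.comp_iff]
  exact hxy

theorem comp_mul_left (hxy : gd.comp x y) (hyz : gd.comp y z) : gd.comp (gd.mul x y) z := by
  rw [gd.comp_iff, gd.src_mul x y hxy, ← gd.comp_iff]
  exact hyz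

theorem inv_mul_cancel_left (h : gd.comp x y) : gd.mul (gd.inv x) (gd.mul x y) = y := by
  rw [← gd.mul_assoc' _ _ _ (gd.comp_inv_left x) h, gd.inv_mul_self, (gd.comp_iff x y).1 h,
    gd.tgt_mul_self]

theorem mul_inv_cancel_right (h : gd.comp x y) : gd.mul (gd.mul x y) (gd.inv y) = x := by
  rw [gd.mul_assoc' _ _ _ h (gd.comp_inv_right y), gd.mul_inv_self, ← (gd.comp_iff x y).1 h,
    gd.mul_src_self]

end PGroupoid

namespace KSgStr.IsKSemigroup

variable {K : Type v} {S : Type w} [Field K] {M : KSgStr K S}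

theorem smul_zero (hM : M.IsKSemigroup) (a : K) : M.smul a M.zero = M.zero := by
  obtain ⟨-, -, -, hss, -, -, -, h0⟩ := hM
  rw [← h0 M.zero, hss, mul_zero]

theorem smul_unit_eq_zero (hM : M.IsKSemigroup) (a : Kˣ) (s : S) :
    M.smul (a : K) s = M.zero ↔ s = M.zero := by
  refine ⟨fun h => ?_, fun h => by rw [h, hM.smul_zero]⟩
  have h' := congrArg (M.smul (↑a⁻¹ : K)) h
  rwa [hM.smul_zero, hM.2.2.2.1, Units.inv_mul, hM.2.2.2.2.1] at h'

end KSgStr.IsKSemigroup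

namespace IsPartialProjRep

variable {G : Type u} {K : Type v} {S : Type w} [Field K] {gd : PGroupoid G} {M : KSgStr K S}
  {Γ : G → S} {x y z : G}

theorem mul_eq_zero_of_not_comp (hM : M.IsKSemigroup) (hΓ : IsPartialProjRep gd M Γ)
    (h : ¬ gd.comp x y) : M.mul (Γ x) (Γ y) = M.zero := by
  obtain ⟨a, ha⟩ := hΓ.2 x y h
  rw [ha, hM.smul_zero]

theorem exists_smul_inv_mul (hΓ : IsPartialProjRep gd M Γ) (h : gd.comp x y) :
    ∃ a : Kˣ, M.mul (M.mul (Γ x) (Γ (gd.inv x))) (Γ (gd.mul x y)) =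
      M.smul (a : K) (M.mul (Γ x) (Γ y)) := by
  have := (hΓ.1 (gd.inv x) (gd.mul x y) (gd.comp_mul_right (gd.comp_inv_left x) h)).1
  rwa [gd.inv_inv, gd.inv_mul_cancel_left h] at this

theorem exists_smul_mul_inv (hΓ : IsPartialProjRep gd M Γ) (h : gd.comp x y) :
    ∃ a : Kˣ, M.mul (M.mul (Γ (gd.mul x y)) (Γ (gd.inv y))) (Γ y) =
      M.smul (a : K) (M.mul (Γ x) (Γ y)) := by
  have := (hΓ.1 (gd.mul x y) (gd.inv y) (gd.comp_mul_left h (gd.comp_inv_right y))).2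
  rwa [gd.inv_inv, gd.mul_inv_cancel_right h] at this

/-- Up to a unit, `Γ(x)Γ(x⁻¹)` fixes `Γ(x)Γ(y)`. -/
theorem exists_smul_regular_left (hM : M.IsKSemigroup) (hΓ : IsPartialProjRep gd M Γ)
    (h : gd.comp x y) :
    ∃ a : Kˣ, M.mul (Γ x) (M.mul (Γ (gd.inv x)) (M.mul (Γ x) (Γ y))) =
      M.smul (a : K) (M.mul (Γ x) (Γ y)) := by
  obtain ⟨a, ha⟩ := (hΓ.1 x y h).1
  obtain ⟨b, hb⟩ := hΓ.exists_smul_inv_mul h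
  obtain ⟨hassoc, -, -, hss, -, -, hms, -⟩ := hM
  rw [hassoc] at ha hb
  exact ⟨a * b, by rw [ha, hms, hb, hss, Units.val_mul]⟩

/-- Up to a unit, `Γ(y⁻¹)Γ(y)` fixes `Γ(x)Γ(y)`. -/
theorem exists_smul_regular_right (hM : M.IsKSemigroup) (hΓ : IsPartialProjRep gd M Γ)
    (h : gd.comp x y) :
    ∃ a : Kˣ, M.mul (M.mul (M.mul (Γ x) (Γ y)) (Γ (gd.inv y))) (Γ y) =
      M.smul (a : K) (M.mul (Γ x) (Γ y)) := by
  obtain ⟨a, ha⟩ := (hΓ.1 x y h).2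
  obtain ⟨b, hb⟩ := hΓ.exists_smul_mul_inv h
  obtain ⟨-, -, -, hss, -, hsm, -, -⟩ := hM
  exact ⟨a * b, by rw [ha, hsm, hb, hss, Units.val_mul]⟩

theorem inv_mul_mul_ne_zero (hM : M.IsKSemigroup) (hΓ : IsPartialProjRep gd M Γ)
    (h : gd.comp x y) {s : S} (hs : M.mul (M.mul (Γ x) (Γ y)) s ≠ M.zero) :
    M.mul (Γ (gd.inv x)) (M.mul (M.mul (Γ x) (Γ y)) s) ≠ M.zero := by
  obtain ⟨a, ha⟩ := hΓ.exists_smul_regular_left hM h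
  intro h0
  apply hs
  rw [← hM.smul_unit_eq_zero a, ← hM.2.2.2.2.2.1, ← ha, hM.1, hM.1 (Γ (gd.inv x)), h0, hM.2.2.1]

theorem mul_mul_inv_ne_zero (hM : M.IsKSemigroup) (hΓ : IsPartialProjRep gd M Γ)
    (h : gd.comp x y) {s : S} (hs : M.mul s (M.mul (Γ x) (Γ y)) ≠ M.zero) :
    M.mul (M.mul s (M.mul (Γ x) (Γ y))) (Γ (gd.inv y)) ≠ M.zero := by
  obtain ⟨a, ha⟩ := hΓ.exists_smul_regular_right hM h
  intro h0
  apply hs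
  rw [← hM.smul_unit_eq_zero a, ← hM.2.2.2.2.2.2.1, ← ha, ← hM.1, ← hM.1 s, h0, hM.2.1]

theorem condA (hM : M.IsKSemigroup) (hΓ : IsPartialProjRep gd M Γ) : PPRcondA gd M Γ := by
  refine ⟨fun x y h => ⟨⟨fun h0 => ?_, fun h0 => ?_⟩, ⟨fun h0 => ?_, fun h0 => ?_⟩⟩,
    fun x y h => hΓ.mul_eq_zero_of_not_comp hM h⟩
  · obtain ⟨a, ha⟩ := hΓ.exists_smul_inv_mul h
    rw [← hM.smul_unit_eq_zero a, ← ha, hM.1, h0, hM.2.2.1]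
  · obtain ⟨a, ha⟩ := (hΓ.1 x y h).1
    rw [← hM.smul_unit_eq_zero a, ← ha, hM.1, h0, hM.2.2.1]
  · obtain ⟨a, ha⟩ := (hΓ.1 x y h).2
    rw [← hM.smul_unit_eq_zero a, ← ha, h0, hM.2.1]
  · obtain ⟨a, ha⟩ := hΓ.exists_smul_mul_inv h
    rw [← hM.smul_unit_eq_zero a, ← ha, h0, hM.2.1]

/-- Where `Γ(x)Γ(y) ≠ 0`, the same unit serves for both relations of a partial projective
representation. -/
theorem exists_common_unit (hM : M.IsKSemigroup) (hc : M.IsKCancellative)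
    (hΓ : IsPartialProjRep gd M Γ) (h : gd.comp x y) (hxy : M.mul (Γ x) (Γ y) ≠ M.zero) :
    ∃ a : Kˣ, M.mul (M.mul (Γ (gd.inv x)) (Γ x)) (Γ y) =
        M.smul (a : K) (M.mul (Γ (gd.inv x)) (Γ (gd.mul x y))) ∧
      M.mul (M.mul (Γ x) (Γ y)) (Γ (gd.inv y)) =
        M.smul (a : K) (M.mul (Γ (gd.mul x y)) (Γ (gd.inv y))) := by
  obtain ⟨⟨a, ha⟩, ⟨b, hb⟩⟩ := hΓ.1 x y h
  have hright : M.mul (M.mul (Γ x) (Γ y)) (Γ (gd.inv y)) ≠ M.zero := by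
    obtain ⟨c, hc'⟩ := hΓ.exists_smul_regular_right hM h
    intro h0
    rw [h0, hM.2.1] at hc'
    exact hxy ((hM.smul_unit_eq_zero c _).1 hc'.symm)
  have hne := hΓ.inv_mul_mul_ne_zero hM h hright
  have h1 : M.mul (Γ (gd.inv x)) (M.mul (M.mul (Γ x) (Γ y)) (Γ (gd.inv y))) =
      M.smul (a : K) (M.mul (Γ (gd.inv x)) (M.mul (Γ (gd.mul x y)) (Γ (gd.inv y)))) := by
    rw [← hM.1, ← hM.1 (Γ (gd.inv x)) (Γ x), ha, hM.2.2.2.2.2.1, hM.1]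
  have h2 : M.mul (Γ (gd.inv x)) (M.mul (M.mul (Γ x) (Γ y)) (Γ (gd.inv y))) =
      M.smul (b : K) (M.mul (Γ (gd.inv x)) (M.mul (Γ (gd.mul x y)) (Γ (gd.inv y)))) := by
    rw [hb, hM.2.2.2.2.2.2.1]
  have hab : (a : K) = b := by
    refine hc _ _ _ (fun h0 => hne ?_) (h1.symm.trans h2)
    rw [h1, h0, hM.smul_zero]
  exact ⟨a, ha, hab ▸ hb⟩

theorem exists_isFactorSetOf (hM : M.IsKSemigroup) (hc : M.IsKCancellative)
    (hΓ : IsPartialProjRep gd M Γ) : ∃ σ : G → G → K, IsFactorSetOf gd M Γ σ := by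
  have key (x y : G) : ∃ c : K, (c ≠ 0 ↔ M.mul (Γ x) (Γ y) ≠ M.zero) ∧
      (gd.comp x y → M.mul (Γ x) (Γ y) ≠ M.zero →
        M.mul (M.mul (Γ (gd.inv x)) (Γ x)) (Γ y) =
          M.smul c (M.mul (Γ (gd.inv x)) (Γ (gd.mul x y))) ∧
        M.mul (M.mul (Γ x) (Γ y)) (Γ (gd.inv y)) =
          M.smul c (M.mul (Γ (gd.mul x y)) (Γ (gd.inv y)))) := by
    by_cases h0 : M.mul (Γ x) (Γ y) = M.zero
    · exact ⟨0, by simp [h0], fun _ hne => absurd h0 hne⟩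
    · have h : gd.comp x y := by_contra fun h => h0 (hΓ.mul_eq_zero_of_not_comp hM h)
      obtain ⟨a, ha⟩ := hΓ.exists_common_unit hM hc h h0
      exact ⟨a, by simp [h0], fun _ _ => ha⟩
  choose σ hσ using key
  exact ⟨σ, fun x y => (hσ x y).1, fun x y => (hσ x y).2⟩

theorem cocycle (hM : M.IsKSemigroup) (hc : M.IsKCancellative) (hΓ : IsPartialProjRep gd M Γ)
    {σ : G → G → K} (hσ : IsFactorSetOf gd M Γ σ) (hxy : gd.comp x y) (hyz : gd.comp y z)
    (hne : M.mul (M.mul (Γ x) (Γ y)) (Γ z) ≠ M.zero) :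
    σ x y * σ (gd.mul x y) z = σ x (gd.mul y z) * σ y z := by
  have hne' : M.mul (Γ (gd.inv x)) (M.mul (M.mul (Γ x) (Γ y)) (M.mul (Γ z) (Γ (gd.inv z)))) ≠
      M.zero := by
    refine hΓ.inv_mul_mul_ne_zero hM hxy ?_
    rw [hM.1] at hne
    have := hΓ.mul_mul_inv_ne_zero hM hyz hne
    rwa [← hM.1, hM.1] at this
  obtain ⟨hassoc, hzm, hmz, hss, -, hsm, hms, -⟩ := id hM
  have hXY : M.mul (Γ x) (Γ y) ≠ M.zero := fun h0 => hne (by rw [h0, hzm])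
  have hYZ : M.mul (Γ y) (Γ z) ≠ M.zero := fun h0 => hne (by rw [hassoc, h0, hmz])
  have e1 : M.mul (Γ (gd.inv x)) (M.mul (M.mul (Γ x) (Γ y)) (M.mul (Γ z) (Γ (gd.inv z)))) =
      M.smul (σ x y) (M.mul (Γ (gd.inv x))
        (M.mul (M.mul (Γ (gd.mul x y)) (Γ z)) (Γ (gd.inv z)))) := by
    rw [← hassoc, ← hassoc (Γ (gd.inv x)) (Γ x), (hσ.2 x y hxy hXY).1, hsm, hassoc, hassoc]
  have e2 : M.mul (Γ (gd.inv x)) (M.mul (M.mul (Γ x) (Γ y)) (M.mul (Γ z) (Γ (gd.inv z)))) =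
      M.smul (σ y z) (M.mul (M.mul (M.mul (Γ (gd.inv x)) (Γ x)) (Γ (gd.mul y z)))
        (Γ (gd.inv z))) := by
    rw [hassoc (Γ x), ← hassoc (Γ y), (hσ.2 y z hyz hYZ).2, hms, hms]
    simp only [hassoc]
  have hXY_Z : M.mul (Γ (gd.mul x y)) (Γ z) ≠ M.zero := fun h0 => hne' (by
    rw [e1, h0, hzm, hmz, hM.smul_zero])
  have hX_YZ : M.mul (Γ x) (Γ (gd.mul y z)) ≠ M.zero := fun h0 => hne' (by
    rw [e2, hassoc (Γ (gd.inv x)), h0, hmz, hzm, hM.smul_zero])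
  rw [(hσ.2 _ _ (gd.comp_mul_left hxy hyz) hXY_Z).2, hms, hss] at e1
  rw [(hσ.2 _ _ (gd.comp_mul_right hxy hyz) hX_YZ).1, hsm, hss, hassoc (Γ (gd.inv x)) (Γ _),
    ← gd.mul_assoc' _ _ _ hxy hyz] at e2
  rw [mul_comm (σ x (gd.mul y z))]
  refine hc _ _ _ (fun h0 => hne' ?_) (e1.symm.trans e2)
  rw [e1, h0, hM.smul_zero]

end IsPartialProjRep

theorem IsFactorSetOf.unique {G : Type u} {K : Type v} {S : Type w} [Field K]
    {gd : PGroupoid G} {M : KSgStr K S} {Γ : G → S} (hc : M.IsKCancellative)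
    (hA : PPRcondA gd M Γ) {σ τ : G → G → K} (hσ : IsFactorSetOf gd M Γ σ)
    (hτ : IsFactorSetOf gd M Γ τ) : σ = τ := by
  funext x y
  by_cases h0 : M.mul (Γ x) (Γ y) = M.zero
  · rw [not_not.1 fun h => (hσ.1 x y).1 h h0, not_not.1 fun h => (hτ.1 x y).1 h h0]
  · have h : gd.comp x y := by_contra fun h => h0 (hA.2 x y h)
    exact hc _ _ _ (fun h' => h0 ((hA.1 x y h).1.1 h'))
      ((hσ.2 x y h h0).1.symm.trans (hτ.2 x y h h0).1)

theorem IsFactorSetOf.isPartialProjRep {G : Type u} {K : Type v} {S : Type w} [Field K]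
    {gd : PGroupoid G} {M : KSgStr K S} {Γ : G → S} (hM : M.IsKSemigroup)
    (hA : PPRcondA gd M Γ) {σ : G → G → K} (hσ : IsFactorSetOf gd M Γ σ) :
    IsPartialProjRep gd M Γ := by
  refine ⟨fun x y h => ?_, fun x y h => ⟨1, by rw [hA.2 x y h, hM.smul_zero]⟩⟩
  by_cases h0 : M.mul (Γ x) (Γ y) = M.zero
  · obtain ⟨h1, h2⟩ := hA.1 x y h
    exact ⟨⟨1, by rw [hM.1, h0, h1.2 h0, hM.2.2.1, hM.smul_zero]⟩,
      ⟨1, by rw [h0, h2.1 h0, hM.2.1, hM.smul_zero]⟩⟩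
  · obtain ⟨h1, h2⟩ := hσ.2 x y h h0
    exact ⟨⟨Units.mk0 _ ((hσ.1 x y).2 h0), h1⟩, ⟨Units.mk0 _ ((hσ.1 x y).2 h0), h2⟩⟩

/-- Let `gd` be a groupoid and `M` a `𝕂`-cancellative semigroup.  A map
`Γ : 𝒢 → S` is a partial projective representation of `gd` (i.e. `ξ∘Γ : 𝒢 → S/λ` is a
partial homomorphism) if and only if (i) condition `PPRcondA` holds, and (ii) there is a
unique map `σ : 𝒢 × 𝒢 → 𝕂`, nonzero exactly on `{(x,y) : Γ(x)Γ(y) ≠ 0}`, satisfying the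
factor-set identities.  Moreover, in that case, for every composable triple `(x,y,z)`,
`Γ(x)Γ(y)Γ(z) ≠ 0` implies `σ(x,y)σ(xy,z) = σ(x,yz)σ(y,z)`. -/
theorem statement8 {G : Type u} {K : Type v} {S : Type w} [Field K]
    (gd : PGroupoid G) (M : KSgStr K S)
    (hM : M.IsKSemigroup) (hc : M.IsKCancellative) (Γ : G → S) :
    (IsPartialProjRep gd M Γ ↔
      (PPRcondA gd M Γ ∧ ∃! σ : G → G → K, IsFactorSetOf gd M Γ σ)) ∧
    (IsPartialProjRep gd M Γ → ∀ σ : G → G → K, IsFactorSetOf gd M Γ σ →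
      ∀ x y z, gd.comp x y → gd.comp y z →
        M.mul (M.mul (Γ x) (Γ y)) (Γ z) ≠ M.zero →
        σ x y * σ (gd.mul x y) z = σ x (gd.mul y z) * σ y z) := by
  refine ⟨⟨fun hΓ => ⟨hΓ.condA hM, ?_⟩, ?_⟩, ?_⟩
  · obtain ⟨σ, hσ⟩ := hΓ.exists_isFactorSetOf hM hc
    exact ⟨σ, hσ, fun τ hτ => hτ.unique hc (hΓ.condA hM) hσ⟩
  · rintro ⟨hA, σ, hσ, -⟩
    exact hσ.isPartialProjRep hM hA
  · intro hΓ σ hσ x y z hxy hyz hne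
    exact hΓ.cocycle hM hc hσ hxy hyz hne
end

section
/- Let Γ be a partial projective representation of a groupoid 𝒢 on a 𝕂-cancellative semigroup, with factor set σ, and let D = dom σ. Then for all x,y ∈ 𝒢: (x,y) ∈ D ⟺ (x⁻¹,xy) ∈ D ⟺ (xy,y⁻¹) ∈ D ⟺ (y,y⁻¹x⁻¹) ∈ D ⟺ (y⁻¹,x⁻¹) ∈ D ⟺ (y⁻¹x⁻¹,x) ∈ D; and (x,d(x)) ∈ D ⟺ (x⁻¹,x) ∈ D ⟺ (d(x),x⁻¹) ∈ D ⟺ (r(x),x) ∈ D. -/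
attribute [local instance] Classical.propDecidable

universe u v w

theorem PGroupoid.inv_mul_cancel_left_s9 {G : Type u} (gd : PGroupoid G) {x y : G}
    (h : gd.comp x y) : gd.mul (gd.inv x) (gd.mul x y) = y := by
  rw [← gd.mul_assoc' _ _ _ (gd.comp_inv_left x) h, gd.inv_mul_self, (gd.comp_iff x y).1 h,
    gd.tgt_mul_self]

theorem PGroupoid.mul_inv_cancel_right_s9 {G : Type u} (gd : PGroupoid G) {x y : G}
    (h : gd.comp x y) : gd.mul (gd.mul x y) (gd.inv y) = x := by
  rw [gd.mul_assoc' _ _ _ h (gd.comp_inv_right y), gd.mul_inv_self, ← (gd.comp_iff x y).1 h,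
    gd.mul_src_self]

theorem PGroupoid.comp_inv_mul {G : Type u} (gd : PGroupoid G) {x y : G}
    (h : gd.comp x y) : gd.comp (gd.inv x) (gd.mul x y) := by
  rw [gd.comp_iff, gd.src_inv, gd.tgt_mul _ _ h]

theorem PGroupoid.comp_mul_inv {G : Type u} (gd : PGroupoid G) {x y : G}
    (h : gd.comp x y) : gd.comp (gd.mul x y) (gd.inv y) := by
  rw [gd.comp_iff, gd.tgt_inv, gd.src_mul _ _ h]

theorem PGroupoid.comp_inv_inv {G : Type u} (gd : PGroupoid G) {x y : G}
    (h : gd.comp x y) : gd.comp (gd.inv y) (gd.inv x) := by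
  rw [gd.comp_iff, gd.src_inv, gd.tgt_inv, (gd.comp_iff x y).1 h]

theorem KSgStr.smul_ne_zero {K : Type v} {S : Type w} [Field K] {M : KSgStr K S}
    (hM : M.IsKSemigroup) (hc : M.IsKCancellative) {a : K} {s : S} (ha : a ≠ 0)
    (hs : s ≠ M.zero) : M.smul a s ≠ M.zero := by
  obtain ⟨-, -, -, -, -, -, -, h0⟩ := hM
  exact fun h => ha (hc a 0 s hs (h.trans (h0 s).symm))

/-- The domain of a factor set is invariant under the two generating involutions. -/
theorem PPRcondA.ne_zero_iff {G : Type u} {K : Type v} {S : Type w} [Field K]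
    {gd : PGroupoid G} {M : KSgStr K S} {Γ : G → S} (hA : PPRcondA gd M Γ) {x y : G}
    (h : gd.comp x y) :
    (M.mul (Γ x) (Γ y) ≠ M.zero ↔ M.mul (Γ (gd.inv x)) (Γ (gd.mul x y)) ≠ M.zero) ∧
    (M.mul (Γ x) (Γ y) ≠ M.zero ↔ M.mul (Γ (gd.mul x y)) (Γ (gd.inv y)) ≠ M.zero) :=
  ⟨not_congr (hA.1 x y h).1.symm, not_congr (hA.1 x y h).2⟩

theorem PPRcondA.mul_inv_ne_zero {G : Type u} {K : Type v} {S : Type w} [Field K]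
    {gd : PGroupoid G} {M : KSgStr K S} {Γ : G → S} (hM : M.IsKSemigroup)
    (hc : M.IsKCancellative) (hA : PPRcondA gd M Γ) {σ : G → G → K}
    (hσ : IsFactorSetOf gd M Γ σ) {x : G}
    (h : M.mul (Γ (gd.inv x)) (Γ x) ≠ M.zero) : M.mul (Γ x) (Γ (gd.inv x)) ≠ M.zero := by
  have hx := (hA.ne_zero_iff (gd.comp_inv_left x)).1.1 h
  have hf := (hσ.2 _ _ (gd.comp_inv_left x) h).1
  rw [gd.inv_inv] at hx hf
  have hne := KSgStr.smul_ne_zero hM hc ((hσ.1 _ _).2 h) hx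
  intro h0
  rw [← hf, h0, hM.2.1] at hne
  exact hne rfl

/-- Let `Γ` be a partial projective representation of the groupoid `gd`
with factor set `σ`, and let `D = dom σ = {(x,y) : Γ(x)Γ(y) ≠ 0}` (membership expressed by
the predicate `Dp`).  Then for composable `x, y`:
`(x,y) ∈ D ⟺ (x⁻¹,xy) ∈ D ⟺ (xy,y⁻¹) ∈ D ⟺ (y,y⁻¹x⁻¹) ∈ D ⟺ (y⁻¹,x⁻¹) ∈ D ⟺ (y⁻¹x⁻¹,x) ∈ D`,
and for every `x`:
`(x,d(x)) ∈ D ⟺ (x⁻¹,x) ∈ D ⟺ (d(x),x⁻¹) ∈ D ⟺ (r(x),x) ∈ D`. -/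
theorem statement9 {G : Type u} {K : Type v} {S : Type w} [Field K]
    (gd : PGroupoid G) (M : KSgStr K S)
    (hM : M.IsKSemigroup) (hc : M.IsKCancellative) (Γ : G → S)
    (hA : PPRcondA gd M Γ) (σ : G → G → K) (hσ : IsFactorSetOf gd M Γ σ)
    (Dp : G → G → Prop) (hDp : ∀ x y, Dp x y ↔ M.mul (Γ x) (Γ y) ≠ M.zero) :
    (∀ x y, gd.comp x y →
      ((Dp x y ↔ Dp (gd.inv x) (gd.mul x y)) ∧
       (Dp x y ↔ Dp (gd.mul x y) (gd.inv y)) ∧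
       (Dp x y ↔ Dp y (gd.mul (gd.inv y) (gd.inv x))) ∧
       (Dp x y ↔ Dp (gd.inv y) (gd.inv x)) ∧
       (Dp x y ↔ Dp (gd.mul (gd.inv y) (gd.inv x)) x))) ∧
    (∀ x, ((Dp x (gd.src x) ↔ Dp (gd.inv x) x) ∧
           (Dp (gd.inv x) x ↔ Dp (gd.src x) (gd.inv x)) ∧
           (Dp (gd.src x) (gd.inv x) ↔ Dp (gd.tgt x) x))) := by
  have hD : ∀ {x y}, gd.comp x y → (Dp x y ↔ Dp (gd.inv x) (gd.mul x y)) ∧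
      (Dp x y ↔ Dp (gd.mul x y) (gd.inv y)) := by
    intro x y h
    simp only [hDp]
    exact hA.ne_zero_iff h
  have hl : ∀ {x y}, gd.comp x y → (Dp x y ↔ Dp y (gd.mul (gd.inv y) (gd.inv x))) := by
    intro x y h
    have := (hD (gd.comp_inv_mul h)).2
    rw [gd.inv_mul_cancel_left_s9 h, gd.inv_mul_rev _ _ h] at this
    exact (hD h).1.trans this
  have hr : ∀ {x y}, gd.comp x y → (Dp x y ↔ Dp (gd.mul (gd.inv y) (gd.inv x)) x) := by
    intro x y h
    have := (hD (gd.comp_mul_inv h)).1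
    rw [gd.mul_inv_cancel_right_s9 h, gd.inv_mul_rev _ _ h] at this
    exact (hD h).2.trans this
  refine ⟨fun x y h => ⟨(hD h).1, (hD h).2, hl h, ?_, hr h⟩, fun x => ⟨?_, ?_, ?_⟩⟩
  · have := (hD (gd.comp_inv_inv h)).1
    rw [gd.inv_inv] at this
    exact (hl h).trans this.symm
  · simpa only [gd.mul_src_self] using (hD (gd.comp_src_self x)).1
  · simpa only [gd.inv_mul_self] using (hD (gd.comp_inv_left x)).2
  · have h₁ := (hD (gd.comp_inv_left x)).2
    have h₂ := (hD (gd.comp_inv_right x)).2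
    rw [gd.inv_mul_self] at h₁
    rw [gd.mul_inv_self, gd.inv_inv] at h₂
    rw [← h₁, ← h₂, hDp, hDp]
    refine ⟨PPRcondA.mul_inv_ne_zero hM hc hA hσ, fun h => ?_⟩
    have := PPRcondA.mul_inv_ne_zero hM hc hA hσ (x := gd.inv x)
    rw [gd.inv_inv] at this
    exact this h
end

section
/- Let Γ be a partial projective representation of a groupoid 𝒢 on a 𝕂-cancellative semigroup, with factor set σ and domain D = dom σ, and assume Γ(r(x)) and Γ(d(x)) are left and right identities for Γ(x) for every x. If (x,y) ∈ D, then (x,d(x)) ∈ D and (r(y),y) ∈ D, and σ(x,d(x)) = σ(r(x),x) = σ(y,d(y)) = σ(r(y),y) = 1. -/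
attribute [local instance] Classical.propDecidable

universe u v w

theorem PGroupoid.inv_src {G : Type u} (gd : PGroupoid G) (x : G) :
    gd.inv (gd.src x) = gd.src x := by
  rw [← gd.inv_mul_self x, gd.inv_mul_rev _ _ (gd.comp_inv_left x), gd.inv_inv]

theorem PGroupoid.inv_tgt {G : Type u} (gd : PGroupoid G) (x : G) :
    gd.inv (gd.tgt x) = gd.tgt x := by
  rw [← gd.mul_inv_self x, gd.inv_mul_rev _ _ (gd.comp_inv_right x), gd.inv_inv]

theorem IsFactorSetOf.apply_src_eq_one {G : Type u} {K : Type v} {S : Type w} [Field K]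
    {gd : PGroupoid G} {M : KSgStr K S} (hM : M.IsKSemigroup) (hc : M.IsKCancellative)
    {Γ : G → S} {σ : G → G → K} (hσ : IsFactorSetOf gd M Γ σ) {x : G}
    (hx : M.mul (Γ x) (Γ (gd.src x)) = Γ x) (h0 : Γ x ≠ M.zero) :
    σ x (gd.src x) = 1 := by
  have h := (hσ.2 x (gd.src x) (gd.comp_src_self x) (by rwa [hx])).2
  rw [gd.inv_src, gd.mul_src_self, hx, hx] at h
  refine hc _ _ _ h0 ?_
  rw [← h, hM.2.2.2.2.1]

theorem IsFactorSetOf.apply_tgt_eq_one {G : Type u} {K : Type v} {S : Type w} [Field K]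
    {gd : PGroupoid G} {M : KSgStr K S} (hM : M.IsKSemigroup) (hc : M.IsKCancellative)
    {Γ : G → S} {σ : G → G → K} (hσ : IsFactorSetOf gd M Γ σ) {x : G}
    (hx : M.mul (Γ (gd.tgt x)) (Γ x) = Γ x) (h0 : Γ x ≠ M.zero) :
    σ (gd.tgt x) x = 1 := by
  have h := (hσ.2 (gd.tgt x) x (gd.comp_tgt_self x) (by rwa [hx])).1
  rw [gd.inv_tgt, gd.tgt_mul_self, hM.1, hx, hx] at h
  refine hc _ _ _ h0 ?_
  rw [← h, hM.2.2.2.2.1]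

/-- Let `Γ` be a partial projective representation of `gd` with factor
set `σ` and domain `D = {(x,y) : Γ(x)Γ(y) ≠ 0}`, such that `Γ(r(x))` and `Γ(d(x))` are left
and right identities for `Γ(x)`.  If `(x,y) ∈ D`, then `(x,d(x)) ∈ D` and `(r(y),y) ∈ D`,
and `σ(x,d(x)) = σ(r(x),x) = σ(y,d(y)) = σ(r(y),y) = 1`. -/
theorem statement10 {G : Type u} {K : Type v} {S : Type w} [Field K]
    (gd : PGroupoid G) (M : KSgStr K S)
    (hM : M.IsKSemigroup) (hc : M.IsKCancellative) (Γ : G → S)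
    (hA : PPRcondA gd M Γ) (σ : G → G → K) (hσ : IsFactorSetOf gd M Γ σ)
    (hid : ∀ x, M.mul (Γ (gd.tgt x)) (Γ x) = Γ x ∧ M.mul (Γ x) (Γ (gd.src x)) = Γ x) :
    ∀ x y, M.mul (Γ x) (Γ y) ≠ M.zero →
      M.mul (Γ x) (Γ (gd.src x)) ≠ M.zero ∧
      M.mul (Γ (gd.tgt y)) (Γ y) ≠ M.zero ∧
      σ x (gd.src x) = 1 ∧ σ (gd.tgt x) x = 1 ∧
      σ y (gd.src y) = 1 ∧ σ (gd.tgt y) y = 1 := by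
  intro x y hxy
  have hx : Γ x ≠ M.zero := fun h => hxy (by rw [h, hM.2.1])
  have hy : Γ y ≠ M.zero := fun h => hxy (by rw [h, hM.2.2.1])
  exact ⟨by rwa [(hid x).2], by rwa [(hid y).1],
    hσ.apply_src_eq_one hM hc (hid x).2 hx, hσ.apply_tgt_eq_one hM hc (hid x).1 hx,
    hσ.apply_src_eq_one hM hc (hid y).2 hy, hσ.apply_tgt_eq_one hM hc (hid y).1 hy⟩
end

section
/- Let A = (A,+,·) be a 𝕂-cancellative 𝕂-algebra, A' = (A,·) the associated 𝕂-cancellative semigroup, α a twisted partial action of a groupoid 𝒢 on the ring A in which every multiplier w_{x,y} is a scalar k(x,y) ∈ 𝕂, and let (α', σ) be the induced twisted partial action of 𝒢 on A' (σ(x,y) = k(x,y)). Then the map A' ⋊_{α',σ} 𝒢 → (A ⋊_α 𝒢)' sending aδ_x to aδ_x is a monomorphism of 𝕂-semigroups, where (A ⋊_α 𝒢)' is the multiplicative 𝕂-cancellative semigroup of the crossed product A ⋊_α 𝒢. -/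
attribute [local instance] Classical.propDecidable

universe u v w

/-- The additive subgroup generated by products `x * y` with `x ∈ X`, `y ∈ Y`,
i.e. the product `X · Y` of two ideals. -/
def setMulAdd {R : Type v} [NonUnitalRing R] (X Y : Set R) : AddSubgroup R :=
  AddSubgroup.closure {r | ∃ x ∈ X, ∃ y ∈ Y, r = x * y}

/-- A twisted partial action of a groupoid on a (non-necessarily unital) ring `R`:
ideals `D g` (each `D (tgt g)` an ideal of `R`, and `D g` an ideal of `D (tgt g)`),
ring isomorphisms `act g : D (inv g) → D g` (with inverse `actinv g`), and invertible
multipliers `w g h` of `D g · D (gh)` (represented by elements acting by left/right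
multiplication, with inverse multiplier `winv g h`), subject to axioms (i)-(vi). -/
structure RingTPA {G : Type u} (gd : PGroupoid G) (R : Type v) [NonUnitalRing R] where
  D : G → AddSubgroup R
  act : G → R → R
  actinv : G → R → R
  w : G → G → R
  winv : G → G → R
  ideal_top : ∀ (g : G) (r : R), ∀ x ∈ D (gd.tgt g),
      r * x ∈ D (gd.tgt g) ∧ x * r ∈ D (gd.tgt g)
  sub : ∀ g, D g ≤ D (gd.tgt g)
  ideal_in : ∀ g, ∀ a ∈ D (gd.tgt g), ∀ x ∈ D g, a * x ∈ D g ∧ x * a ∈ D g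
  act_bij : ∀ g, Set.BijOn (act g) ((D (gd.inv g) : Set R)) ((D g : Set R))
  act_add : ∀ g, ∀ a ∈ D (gd.inv g), ∀ b ∈ D (gd.inv g), act g (a + b) = act g a + act g b
  act_mul : ∀ g, ∀ a ∈ D (gd.inv g), ∀ b ∈ D (gd.inv g), act g (a * b) = act g a * act g b
  actinv_mem : ∀ g, ∀ a ∈ D g, actinv g a ∈ D (gd.inv g)
  act_actinv : ∀ g, ∀ a ∈ D g, act g (actinv g a) = a
  actinv_act : ∀ g, ∀ a ∈ D (gd.inv g), actinv g (act g a) = a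
  -- (i)
  sq : ∀ g, setMulAdd ((D g : Set R)) ((D g : Set R)) = D g
  comm : ∀ g h, setMulAdd ((D g : Set R)) ((D h : Set R)) = setMulAdd ((D h : Set R)) ((D g : Set R))
  -- (ii)
  id_eq : ∀ e, gd.isId e → D e = D (gd.tgt e)
  act_id : ∀ e, gd.isId e → ∀ a ∈ D e, act e a = a
  -- (iii)
  act_ideal : ∀ g h, gd.comp g h →
      act g '' ((setMulAdd ((D (gd.inv g) : Set R)) ((D h : Set R)) : AddSubgroup R) : Set R) =
        ((setMulAdd ((D g : Set R)) ((D (gd.mul g h) : Set R)) : AddSubgroup R) : Set R)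
  -- `w g h` is an invertible multiplier of `D g · D (gh)`
  w_mul_mem : ∀ g h, gd.comp g h → ∀ x ∈ setMulAdd ((D g : Set R)) ((D (gd.mul g h) : Set R)),
      w g h * x ∈ setMulAdd ((D g : Set R)) ((D (gd.mul g h) : Set R)) ∧
      x * w g h ∈ setMulAdd ((D g : Set R)) ((D (gd.mul g h) : Set R))
  winv_mul_mem : ∀ g h, gd.comp g h → ∀ x ∈ setMulAdd ((D g : Set R)) ((D (gd.mul g h) : Set R)),
      winv g h * x ∈ setMulAdd ((D g : Set R)) ((D (gd.mul g h) : Set R)) ∧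
      x * winv g h ∈ setMulAdd ((D g : Set R)) ((D (gd.mul g h) : Set R))
  w_winv : ∀ g h, gd.comp g h → ∀ x ∈ setMulAdd ((D g : Set R)) ((D (gd.mul g h) : Set R)),
      w g h * (winv g h * x) = x ∧ winv g h * (w g h * x) = x ∧
      (x * w g h) * winv g h = x ∧ (x * winv g h) * w g h = x
  -- (iv)
  act_act : ∀ g h, gd.comp g h →
      ∀ a ∈ setMulAdd ((D (gd.inv h) : Set R)) ((D (gd.mul (gd.inv h) (gd.inv g)) : Set R)),
      act g (act h a) = w g h * act (gd.mul g h) a * winv g h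
  -- (v)
  w_id_left : ∀ g, ∀ x ∈ D g, w (gd.tgt g) g * x = x ∧ x * w (gd.tgt g) g = x
  w_id_right : ∀ g, ∀ x ∈ D g, w g (gd.src g) * x = x ∧ x * w g (gd.src g) = x
  -- (vi)
  w_cocycle : ∀ g h t, gd.comp g h → gd.comp h t →
      ∀ a ∈ setMulAdd
          ((setMulAdd ((D (gd.inv g) : Set R)) ((D h : Set R)) : AddSubgroup R) : Set R)
          ((D (gd.mul h t) : Set R)),
      act g (a * w h t) * w g (gd.mul h t) = act g a * w g h * w (gd.mul g h) t

/-- The multiplication of the twisted crossed product `R ⋊_{α,w} 𝒢`, realized on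
finitely supported functions `G →₀ R`:
`(a δ_g)(b δ_h) = α_g(α_g⁻¹(a) b) w_{g,h} δ_{gh}` when `(g,h)` is composable, `0` otherwise. -/
noncomputable def cpMul {G : Type u} {R : Type v} [NonUnitalRing R] (gd : PGroupoid G)
    (A : RingTPA gd R) (f f' : G →₀ R) : G →₀ R :=
  f.sum fun g a => f'.sum fun h b =>
    if gd.comp g h then Finsupp.single (gd.mul g h) (A.act g (A.actinv g a * b) * A.w g h) else 0

/-- A twisted partial action `(θ, σ)` of the groupoid `gd` on the `𝕂`-semigroup `M` with
ambient carrier `amb` (the semigroup being acted on): ideals `Sx g ⊆ amb`, semigroup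
isomorphisms `θ g : Sx (inv g) → Sx g` (with inverse `θinv g`) which are `𝕂`-maps, each
ideal a monoid with identity `one g`, and a twisting `σ` satisfying:
`σ(x,y) = 0 ⟺ S_x ∩ S_{xy} = 0` for composable `(x,y)`; `σ(x,d(x)) = σ(r(x),x) = 1`;
the 2-cocycle identity when `S_x ∩ S_{xy} ∩ S_{xyz} ≠ 0`; and `σ = 0` on non-composable
pairs. -/
def IsSgTPA {G : Type u} {K : Type v} {S : Type w} [Field K]
    (gd : PGroupoid G) (M : KSgStr K S) (amb : Set S)
    (Sx : G → Set S) (θ θinv : G → S → S) (one : G → S) (σ : G → G → K) : Prop :=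
  (∀ g, Sx g ⊆ amb) ∧
  (∀ g, ∀ s ∈ Sx g, ∀ t ∈ amb, M.mul t s ∈ Sx g ∧ M.mul s t ∈ Sx g) ∧
  (∀ g, Sx g ⊆ Sx (gd.tgt g)) ∧
  (∀ g, Set.BijOn (θ g) (Sx (gd.inv g)) (Sx g)) ∧
  (∀ g, ∀ a ∈ Sx (gd.inv g), ∀ b ∈ Sx (gd.inv g),
      θ g (M.mul a b) = M.mul (θ g a) (θ g b)) ∧
  (∀ g, ∀ a ∈ Sx g, θinv g a ∈ Sx (gd.inv g) ∧ θ g (θinv g a) = a) ∧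
  (∀ g, ∀ a ∈ Sx (gd.inv g), θinv g (θ g a) = a) ∧
  (∀ e, gd.isId e → ∀ a ∈ Sx e, θ e a = a) ∧
  (∀ g h, gd.comp g h → θ g '' (Sx (gd.inv g) ∩ Sx h) = Sx g ∩ Sx (gd.mul g h)) ∧
  (∀ g h, gd.comp g h → ∀ a ∈ Sx (gd.inv h) ∩ Sx (gd.inv (gd.mul g h)),
      θ g (θ h a) = θ (gd.mul g h) a) ∧
  (∀ g, one g ∈ Sx g) ∧
  (∀ g, ∀ a ∈ Sx g, M.mul (one g) a = a ∧ M.mul a (one g) = a) ∧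
  (∀ g (k : K), ∀ a ∈ Sx (gd.inv g), θ g (M.smul k a) = M.smul k (θ g a)) ∧
  (∀ g h, gd.comp g h → (σ g h = 0 ↔ Sx g ∩ Sx (gd.mul g h) ⊆ {M.zero})) ∧
  (∀ g, σ g (gd.src g) = 1 ∧ σ (gd.tgt g) g = 1) ∧
  (∀ g h t, gd.comp g h → gd.comp h t →
      ¬(Sx g ∩ Sx (gd.mul g h) ∩ Sx (gd.mul g (gd.mul h t)) ⊆ {M.zero}) →
      σ g h * σ (gd.mul g h) t = σ h t * σ g (gd.mul h t)) ∧
  (∀ g h, ¬ gd.comp g h → σ g h = 0)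

/-- The crossed product `S ⋊_{θ,σ} 𝒢 = L/I`: its elements are `0` (= `none`) and the
classes of the `a δ_x` with `a ≠ 0` (= `some (x, a)`), with multiplication
`(a δ_x)(b δ_y) = σ(x,y)·θ_x(θ_x⁻¹(a) b) δ_{xy}` when `xy` is defined (collapsed to `0`
when the coefficient is `0`), and `0` otherwise. -/
noncomputable def sgCPStr {G : Type u} {K : Type v} {S : Type w} [Field K]
    (gd : PGroupoid G) (M : KSgStr K S) (θ θinv : G → S → S) (σ : G → G → K) :
    KSgStr K (Option (G × S)) where
  zero := none
  mul p q :=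
    match p, q with
    | some (x, a), some (y, b) =>
        if gd.comp x y then
          if M.smul (σ x y) (θ x (M.mul (θinv x a) b)) = M.zero then none
          else some (gd.mul x y, M.smul (σ x y) (θ x (M.mul (θinv x a) b)))
        else none
    | _, _ => none
  smul k p :=
    match p with
    | none => none
    | some (x, a) => if M.smul k a = M.zero then none else some (x, M.smul k a)

/-- The legal elements of the crossed product: `0`, and the `a δ_x` with `a ∈ S_x`,
`a ≠ 0`. -/
def sgLegal {G : Type u} {S : Type w} (Sx : G → Set S) (z : S)
    (p : Option (G × S)) : Prop :=
  ∀ x a, p = some (x, a) → a ∈ Sx x ∧ a ≠ z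

/-- The subsemigroup of `M` generated by a subset `X`. -/
def genSubSg {K : Type v} {S : Type w} (M : KSgStr K S) (X : Set S) : Set S :=
  ⋂₀ {Y : Set S | X ⊆ Y ∧ ∀ a ∈ Y, ∀ b ∈ Y, M.mul a b ∈ Y}

/-- The multiplicative `𝕂`-semigroup `A' = (A, ·)` of a `𝕂`-algebra `A`. -/
def ringKSg (K : Type v) (A : Type w) [Field K] [NonUnitalRing A] [Module K A] :
    KSgStr K A where
  mul x y := x * y
  zero := 0
  smul k x := k • x


namespace RingTPA

variable {G : Type u} {R : Type v} [NonUnitalRing R] {gd : PGroupoid G} (T : RingTPA gd R)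

theorem act_zero (g : G) : T.act g 0 = 0 := by
  simpa using T.act_add g 0 (zero_mem _) 0 (zero_mem _)

theorem actinv_zero (g : G) : T.actinv g 0 = 0 := by
  simpa [T.act_zero] using T.actinv_act g 0 (zero_mem _)

theorem act_actinv_mul_mem {g h : G} (hgh : gd.comp g h) {a b : R} (ha : a ∈ T.D g)
    (hb : b ∈ T.D h) :
    T.act g (T.actinv g a * b) ∈
      setMulAdd ((T.D g : Set R)) ((T.D (gd.mul g h) : Set R)) := by
  rw [← SetLike.mem_coe, ← T.act_ideal g h hgh]
  exact Set.mem_image_of_mem _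
    (AddSubgroup.subset_closure ⟨_, T.actinv_mem g a ha, b, hb, rfl⟩)

theorem cpMul_single (g h : G) (a b : R) :
    cpMul gd T (Finsupp.single g a) (Finsupp.single h b) =
      if gd.comp g h then
        Finsupp.single (gd.mul g h) (T.act g (T.actinv g a * b) * T.w g h)
      else 0 := by
  unfold cpMul
  rw [Finsupp.sum_single_index (by simp [T.actinv_zero, T.act_zero]),
    Finsupp.sum_single_index (by simp [T.act_zero])]

end RingTPA

/-- Let `A` be a `𝕂`-cancellative `𝕂`-algebra, `TA` a twisted partial
action of the groupoid `gd` on the ring `A` in which every multiplier `w_{x,y}` is the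
scalar `k(x,y) ∈ 𝕂`, and `(α', σ)` the induced twisted partial action on the multiplicative
semigroup `A' = (A,·)`.  Then the map `a δ_x ↦ a δ_x` from `A' ⋊_{α',σ} 𝒢` to
`(A ⋊_α 𝒢)'` is a monomorphism of `𝕂`-semigroups: it sends `0` to `0`, preserves
multiplication and the `𝕂`-action, and is injective. -/
theorem statement15 {G : Type u} {K : Type v} {A : Type w} [Field K]
    [NonUnitalRing A] [Module K A] [SMulCommClass K A A] [IsScalarTower K A A]
    (hcanc : ∀ (a b : K) (x : A), x ≠ 0 → a • x = b • x → a = b)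
    (gd : PGroupoid G) (TA : RingTPA gd A)
    (one : G → A)
    (hone_mem : ∀ g, one g ∈ TA.D g)
    (hone : ∀ g, ∀ x ∈ TA.D g, one g * x = x ∧ x * one g = x)
    (hlin : ∀ g (c : K), ∀ a ∈ TA.D (gd.inv g), TA.act g (c • a) = c • TA.act g a)
    (k : G → G → K)
    (hk : ∀ g h, gd.comp g h →
        ∀ x ∈ setMulAdd ((TA.D g : Set A)) ((TA.D (gd.mul g h) : Set A)),
        TA.w g h * x = k g h • x ∧ x * TA.w g h = k g h • x)
    (σ : G → G → K) (hσ : ∀ g h, σ g h = if gd.comp g h then k g h else 0)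
    (φ : Option (G × A) → (G →₀ A))
    (hφ0 : φ none = 0)
    (hφs : ∀ (x : G) (a : A), φ (some (x, a)) = Finsupp.single x a)
 :
    (∀ p q : Option (G × A),
      sgLegal (fun g => ((TA.D g : Set A))) (0 : A) p →
      sgLegal (fun g => ((TA.D g : Set A))) (0 : A) q →
      φ ((sgCPStr gd (ringKSg K A) TA.act TA.actinv σ).mul p q) =
        cpMul gd TA (φ p) (φ q)) ∧
    (∀ (c : K) (p : Option (G × A)),
      sgLegal (fun g => ((TA.D g : Set A))) (0 : A) p →
      φ ((sgCPStr gd (ringKSg K A) TA.act TA.actinv σ).smul c p) = c • φ p) ∧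
    Set.InjOn φ {p : Option (G × A) | sgLegal (fun g => ((TA.D g : Set A))) (0 : A) p} := by
  have collapse (x : G) (a : A) :
      φ (if a = 0 then none else some (x, a)) = Finsupp.single x a := by
    split_ifs with ha
    · rw [hφ0, ha, Finsupp.single_zero]
    · exact hφs x a
  refine ⟨?_, ?_, ?_⟩
  · rintro (_ | ⟨x, a⟩) (_ | ⟨y, b⟩) hp hq
    · simp [sgCPStr, cpMul, hφ0]
    · simp [sgCPStr, cpMul, hφ0]
    · simp [sgCPStr, cpMul, hφ0]
    · rw [hφs, hφs, TA.cpMul_single]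
      by_cases hxy : gd.comp x y
      · have hmem := TA.act_actinv_mul_mem hxy (hp x a rfl).1 (hq y b rfl).1
        rw [if_pos hxy, (hk x y hxy _ hmem).2]
        simpa only [sgCPStr, ringKSg, hxy, hσ, if_true] using collapse _ _
      · simp [sgCPStr, hxy, hφ0]
  · rintro c (_ | ⟨x, a⟩) -
    · simp [sgCPStr, hφ0]
    · rw [hφs, Finsupp.smul_single]
      exact collapse x (c • a)
  · rintro (_ | ⟨x, a⟩) hp (_ | ⟨y, b⟩) hq h
    · rfl
    · rw [hφ0, hφs, eq_comm, Finsupp.single_eq_zero] at h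
      exact absurd h (hq y b rfl).2
    · rw [hφ0, hφs, Finsupp.single_eq_zero] at h
      exact absurd h (hp x a rfl).2
    · rw [hφs, hφs, Finsupp.single_eq_single_iff] at h
      obtain ⟨rfl, rfl⟩ | ⟨h, -⟩ := h
      · rfl
      · exact absurd h (hp x a rfl).2
end
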